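/- arXiv:2104.06134 — 12 statements merged into one kernel-verified Lean document; each statement's English description precedes it below -/
import Mathlib

section
/- Let N be a weakly J-submodule of an R-module M with N ⊆ J(R)M. If N is not a J-submodule of M, then (N : M)·N = 0; in particular (N : M)² ⊆ Ann(M). Consequently, a weakly J-submodule N ⊆ J(R)M with (N : M)·N ≠ 0 is a J-submodule. -/
/-- The ideal `(J(R)M : M) = {r : R | r • M ⊆ J(R)M}`. -/
def jacobsonColon (R : Type*) [CommRing R] (M : Type*) [AddCommGroup M] [Module R M] :
    Ideal R :=
  Submodule.colon ((⊥ : Ideal R).jacobson • (⊤ : Submodule R M)) ⊤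

/-- `N` is a J-submodule: proper, and `r • m ∈ N` with `r ∉ (J(R)M : M)` implies `m ∈ N`. -/
def IsJSubmodule {R : Type*} [CommRing R] {M : Type*} [AddCommGroup M] [Module R M]
    (N : Submodule R M) : Prop :=
  N ≠ ⊤ ∧ ∀ (r : R) (m : M), r • m ∈ N → r ∉ jacobsonColon R M → m ∈ N

/-- `N` is a weakly J-submodule: proper, and `0 ≠ r • m ∈ N` with `r ∉ (J(R)M : M)`
implies `m ∈ N`. -/
def IsWeaklyJSubmodule {R : Type*} [CommRing R] {M : Type*} [AddCommGroup M] [Module R M]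
    (N : Submodule R M) : Prop :=
  N ≠ ⊤ ∧ ∀ (r : R) (m : M), r • m ∈ N → r • m ≠ 0 → r ∉ jacobsonColon R M → m ∈ N

/-- `I` is a weakly J-ideal: proper, and `0 ≠ a * b ∈ I` with `a ∉ J(R)` implies `b ∈ I`. -/
def IsWeaklyJIdeal {R : Type*} [CommRing R] (I : Ideal R) : Prop :=
  I ≠ ⊤ ∧ ∀ a b : R, a * b ∈ I → a * b ≠ 0 → a ∉ (⊥ : Ideal R).jacobson → b ∈ I

/-- `M` is a multiplication module: every submodule is of the form `I • ⊤`. -/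
def IsMultiplicationModule (R : Type*) [CommRing R] (M : Type*) [AddCommGroup M]
    [Module R M] : Prop :=
  ∀ N : Submodule R M, ∃ I : Ideal R, N = I • (⊤ : Submodule R M)

/-- The submodule `(N :_M S) = {m : M | s • m ∈ N for all s ∈ S}`. -/
def setColon {R : Type*} [CommRing R] {M : Type*} [AddCommGroup M] [Module R M]
    (N : Submodule R M) (S : Set R) : Submodule R M :=
  ⨅ s ∈ S, N.comap (s • (LinearMap.id : M →ₗ[R] M))

theorem stmt2 {R : Type*} [CommRing R] {M : Type*} [AddCommGroup M] [Module R M]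
    (N : Submodule R M) (hN : IsWeaklyJSubmodule N)
    (hsub : N ≤ (⊥ : Ideal R).jacobson • (⊤ : Submodule R M)) :
    (¬ IsJSubmodule N →
      Submodule.colon N ⊤ • N = (⊥ : Submodule R M) ∧
      (Submodule.colon N ⊤) ^ 2 ≤ Module.annihilator R M) ∧
    (Submodule.colon N ⊤ • N ≠ (⊥ : Submodule R M) → IsJSubmodule N) := by
  have key : ¬ IsJSubmodule N → ∀ a ∈ Submodule.colon N (⊤ : Set M), ∀ n ∈ N, a • n = 0 := by
    intro hJ a ha n hn
    have hex : ∃ (r : R) (m : M), r • m ∈ N ∧ r ∉ jacobsonColon R M ∧ m ∉ N := by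
      by_contra hc
      push Not at hc
      exact hJ ⟨hN.1, hc⟩
    obtain ⟨r, m, hrm, hr, hm⟩ := hex
    have h0 : r • m = 0 := by
      by_contra h
      exact hm (hN.2 r m hrm h hr)
    have haM : ∀ x : M, a • x ∈ N := fun x => Submodule.mem_colon.1 ha x trivial
    have haJ : a ∈ jacobsonColon R M :=
      Submodule.mem_colon.2 fun x _ => hsub (haM x)
    have hra : r + a ∉ jacobsonColon R M := fun h =>
      hr ((Submodule.add_mem_iff_left _ haJ).1 h)
    have hmn : m + n ∉ N := fun h => hm ((Submodule.add_mem_iff_left _ hn).1 h)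
    have h1 : r • n = 0 := by
      by_contra h
      have e : r • (m + n) = r • n := by rw [smul_add, h0, zero_add]
      exact hmn (hN.2 r (m + n) (e ▸ N.smul_mem r hn) (e ▸ h) hr)
    have h2 : a • m = 0 := by
      by_contra h
      have e : (r + a) • m = a • m := by rw [add_smul, h0, zero_add]
      exact hm (hN.2 (r + a) m (e ▸ haM m) (e ▸ h) hra)
    by_contra h
    have e : (r + a) • (m + n) = a • n := by
      rw [smul_add, add_smul, add_smul, h0, h1, h2]; simp
    exact hmn (hN.2 (r + a) (m + n) (e ▸ haM n) (e ▸ h) hra)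
  have key2 : ¬ IsJSubmodule N → Submodule.colon N ⊤ • N = (⊥ : Submodule R M) := by
    intro hJ
    rw [eq_bot_iff, Submodule.smul_le]
    intro a ha n hn
    exact (Submodule.mem_bot R).2 (key hJ a ha n hn)
  refine ⟨fun hJ => ⟨key2 hJ, ?_⟩, fun h => by_contra fun hJ => h (key2 hJ)⟩
  rw [pow_two, Ideal.mul_le]
  intro a ha b hb
  rw [Module.mem_annihilator]
  intro x
  rw [mul_smul]
  exact key hJ a ha _ (Submodule.mem_colon.1 hb x trivial)
end

section
/- A proper submodule N of an R-module M is a weakly J-submodule if and only if for every ideal I of R and every m ∈ M with 0 ≠ Im ⊆ N (i.e., Im ⊆ N and Im ≠ 0), either I ⊆ (J(R)M : M) or m ∈ N. -/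
theorem stmt4 {R : Type*} [CommRing R] {M : Type*} [AddCommGroup M] [Module R M]
    (N : Submodule R M) (hN : N ≠ ⊤) :
    IsWeaklyJSubmodule N ↔
      ∀ (I : Ideal R) (m : M), (∀ a ∈ I, a • m ∈ N) → (∃ a ∈ I, a • m ≠ 0) →
        I ≤ jacobsonColon R M ∨ m ∈ N := by
  constructor
  · rintro ⟨-, h⟩ I m hI ⟨a, ha, ham⟩
    by_contra hc
    rw [not_or] at hc
    obtain ⟨hle, hm⟩ := hc
    obtain ⟨r, hr, hrc⟩ := Set.not_subset.mp hle
    have hac : a ∈ jacobsonColon R M := by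
      by_contra hac
      exact hm (h a m (hI a ha) ham hac)
    have hr0 : r • m = 0 := by
      by_contra hr0
      exact hm (h r m (hI r hr) hr0 hrc)
    refine hm (h (r + a) m (hI _ (I.add_mem hr ha)) ?_ ?_)
    · rwa [add_smul, hr0, zero_add]
    · intro hra
      exact hrc (((jacobsonColon R M).add_mem_iff_left hac).mp hra)
  · intro h
    refine ⟨hN, fun r m hrm hr0 hrc => ?_⟩
    have hs : ∀ a ∈ Ideal.span {r}, a • m ∈ N := by
      intro a ha
      obtain ⟨c, rfl⟩ := Ideal.mem_span_singleton'.mp ha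
      rw [mul_smul]
      exact N.smul_mem c hrm
    rcases h (Ideal.span {r}) m hs ⟨r, Ideal.mem_span_singleton_self r, hr0⟩ with h1 | h1
    · exact absurd (h1 (Ideal.mem_span_singleton_self r)) hrc
    · exact h1
end

section
/- A proper submodule N of an R-module M is a weakly J-submodule if and only if for every ideal I of R and every submodule K of M with IK ⊆ N and IK ≠ 0, either I ⊆ (J(R)M : M) or K ⊆ N. -/
theorem stmt5 {R : Type*} [CommRing R] {M : Type*} [AddCommGroup M] [Module R M]
    (N : Submodule R M) (hN : N ≠ ⊤) :
    IsWeaklyJSubmodule N ↔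
      ∀ (I : Ideal R) (K : Submodule R M), I • K ≤ N → I • K ≠ (⊥ : Submodule R M) →
        I ≤ jacobsonColon R M ∨ K ≤ N := by
  constructor
  · rintro ⟨-, h⟩ I K hle hne
    by_contra hcon
    rw [not_or] at hcon
    obtain ⟨h1, h2⟩ := hcon
    obtain ⟨r, hrI, hrC⟩ := SetLike.not_le_iff_exists.1 h1
    obtain ⟨k, hkK, hkN⟩ := SetLike.not_le_iff_exists.1 h2
    have key : ∀ a ∈ I, a ∉ jacobsonColon R M → ∀ m ∈ K, m ∉ N → a • m = 0 := by
      intro a ha haC m hm hmN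
      by_contra h0
      exact hmN (h a m (hle (Submodule.smul_mem_smul ha hm)) h0 haC)
    have key2 : ∀ a ∈ I, ∀ m ∈ K, m ∉ N → a • m = 0 := by
      intro a ha m hm hmN
      by_cases haC : a ∈ jacobsonColon R M
      · have e1 := key r hrI hrC m hm hmN
        have e2 := key (r + a) (I.add_mem hrI ha)
          (fun hh => hrC ((Submodule.add_mem_iff_left _ haC).1 hh)) m hm hmN
        rwa [add_smul, e1, zero_add] at e2
      · exact key a ha haC m hm hmN
    apply hne
    rw [eq_bot_iff, Submodule.smul_le]
    intro a ha m hm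
    rw [Submodule.mem_bot]
    by_cases hmN : m ∈ N
    · have e1 := key2 a ha k hkK hkN
      have e2 := key2 a ha (k + m) (K.add_mem hkK hm)
        (fun hh => hkN ((Submodule.add_mem_iff_left _ hmN).1 hh))
      rwa [smul_add, e1, zero_add] at e2
    · exact key2 a ha m hm hmN
  · intro h
    refine ⟨hN, fun r m hm h0 hr => ?_⟩
    have e : Ideal.span {r} • Submodule.span R {m} = Submodule.span R {r • m} := by
      rw [Ideal.span, Submodule.span_smul_span, Set.singleton_smul_singleton]
    have a1 : Ideal.span {r} • Submodule.span R {m} ≤ N := by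
      rw [e, Submodule.span_singleton_le_iff_mem]
      exact hm
    have a2 : Ideal.span {r} • Submodule.span R {m} ≠ ⊥ := by
      rw [e, Ne, Submodule.span_singleton_eq_bot]
      exact h0
    rcases h (Ideal.span {r}) (Submodule.span R {m}) a1 a2 with h1 | h1
    · exact absurd (h1 (Ideal.mem_span_singleton_self r)) hr
    · exact h1 (Submodule.mem_span_singleton_self m)
end

section
/- Let M be a finitely generated faithful multiplication R-module and I an ideal of R. Then I is a weakly J-ideal of R if and only if IM is a weakly J-submodule of M. -/
theorem aux_cancel {R : Type*} [CommRing R] {M : Type*} [AddCommGroup M] [Module R M]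
    [Module.Finite R M] (hfaith : Module.annihilator R M = ⊥)
    (hmult : IsMultiplicationModule R M) (I : Ideal R) (a : R)
    (ha : ∀ m : M, a • m ∈ I • (⊤ : Submodule R M)) : a ∈ I := by
  have hz : ∀ r : R, (∀ m : M, r • m = 0) → r = 0 := by
    intro r hr
    have : r ∈ Module.annihilator R M := Module.mem_annihilator.2 hr
    rw [hfaith] at this
    simpa using this
  let L : Ideal R := Ideal.radical (Submodule.comap (LinearMap.mulRight R a) I)
  have hL : (⊤ : Submodule R M) ≤ L • (⊤ : Submodule R M) := by
    intro m _
    obtain ⟨K, hK⟩ := hmult (Submodule.span R {m})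
    have hKL : K ≤ L := by
      intro k hk
      have hkm : ∀ n : M, ∃ c : R, c • m = k • n := by
        intro n
        have : k • n ∈ K • (⊤ : Submodule R M) :=
          Submodule.smul_mem_smul hk Submodule.mem_top
        rw [← hK] at this
        exact Submodule.mem_span_singleton.1 this
      have h1 : ∀ n ∈ I • (⊤ : Submodule R M), ∃ x ∈ I, x • m = k • n := by
        intro n hn
        induction hn using Submodule.smul_induction_on' with
        | smul r hr n _ =>
          obtain ⟨c, hc⟩ := hkm n
          exact ⟨r * c, I.mul_mem_right _ hr, by rw [mul_smul, hc, smul_comm]⟩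
        | add x _ y _ hx hy =>
          obtain ⟨c, hc, hc'⟩ := hx
          obtain ⟨d, hd, hd'⟩ := hy
          exact ⟨c + d, I.add_mem hc hd, by rw [add_smul, hc', hd', smul_add]⟩
      obtain ⟨x, hx, hxm⟩ := h1 _ (ha m)
      have h2 : (k * a - x) * k = 0 := by
        apply hz
        intro n
        obtain ⟨c, hc⟩ := hkm n
        rw [mul_smul, ← hc, smul_comm, sub_smul, mul_smul, hxm, sub_self, smul_zero]
      refine ⟨2, ?_⟩
      change k ^ 2 * a ∈ I
      have : k ^ 2 * a = x * k := by linear_combination h2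
      rw [this]
      exact I.mul_mem_right _ hx
    apply Submodule.smul_mono_left hKL
    rw [← hK]
    exact Submodule.mem_span_singleton_self m
  obtain ⟨r, hr, hr'⟩ := Submodule.exists_sub_one_mem_and_smul_eq_zero_of_fg_of_le_smul L
    (⊤ : Submodule R M) Module.Finite.fg_top hL
  have hr0 : r = 0 := hz r fun m => hr' m Submodule.mem_top
  have h1 : (1 : R) ∈ L := by
    rw [hr0, zero_sub] at hr
    simpa using L.neg_mem hr
  obtain ⟨n, hn⟩ := h1
  rw [one_pow] at hn
  simpa using hn

theorem aux_jac {R : Type*} [CommRing R] {M : Type*} [AddCommGroup M] [Module R M]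
    [Module.Finite R M] (hfaith : Module.annihilator R M = ⊥)
    (hmult : IsMultiplicationModule R M) : jacobsonColon R M = (⊥ : Ideal R).jacobson := by
  apply le_antisymm
  · intro r hr
    apply aux_cancel hfaith hmult
    intro m
    exact Submodule.mem_colon.1 hr m trivial
  · intro r hr
    exact Submodule.mem_colon.2 fun m _ => Submodule.smul_mem_smul hr Submodule.mem_top

theorem stmt6 {R : Type*} [CommRing R] {M : Type*} [AddCommGroup M] [Module R M]
    [Module.Finite R M] (hfaith : Module.annihilator R M = ⊥)
    (hmult : IsMultiplicationModule R M) (I : Ideal R) :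
    IsWeaklyJIdeal I ↔ IsWeaklyJSubmodule (I • (⊤ : Submodule R M)) := by 
  have hJ := aux_jac hfaith hmult
  have hc := aux_cancel hfaith hmult
  constructor
  · rintro ⟨hI, h⟩
    refine ⟨fun ht => hI ((Ideal.eq_top_iff_one _).2 (hc I 1 fun m => by rw [ht]; trivial)), ?_⟩
    intro r m hrm h0 hr
    rw [hJ] at hr
    obtain ⟨K, hK⟩ := hmult (Submodule.span R {m})
    have hmK : m ∈ K • (⊤ : Submodule R M) := hK ▸ Submodule.mem_span_singleton_self m
    have hrK : ∀ k ∈ K, r * k ∈ I := by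
      intro k hk
      apply hc
      intro n
      have : k • n ∈ K • (⊤ : Submodule R M) :=
        Submodule.smul_mem_smul hk Submodule.mem_top
      rw [← hK] at this
      obtain ⟨c, hc⟩ := Submodule.mem_span_singleton.1 this
      rw [mul_smul, ← hc, smul_comm]
      exact Submodule.smul_mem _ _ hrm
    obtain ⟨k0, hk0, hne⟩ : ∃ k ∈ K, r * k ≠ 0 := by
      by_contra! hcon
      apply h0
      clear hrm h0 hK
      induction hmK using Submodule.smul_induction_on' with
      | smul k hk n _ => rw [← mul_smul, hcon k hk, zero_smul]
      | add x _ y _ hx hy => rw [smul_add, hx, hy, add_zero]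
    have hk0I : k0 ∈ I := h r k0 (hrK _ hk0) hne hr
    have hKI : K ≤ I := by
      intro k hk
      by_cases hk' : r * k = 0
      · have := h r (k + k0) (hrK _ (K.add_mem hk hk0)) (by rwa [mul_add, hk', zero_add]) hr
        simpa using I.sub_mem this hk0I
      · exact h r k (hrK _ hk) hk' hr
    exact Submodule.smul_mono_left hKI hmK
  · rintro ⟨hI, h⟩
    refine ⟨fun ht => hI (by rw [ht, Submodule.top_smul]), ?_⟩
    intro a b hab h0 ha
    rw [← hJ] at ha
    have habM : ∀ m : M, a • b • m ∈ I • (⊤ : Submodule R M) := fun m => by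
      rw [← mul_smul]
      exact Submodule.smul_mem_smul hab Submodule.mem_top
    obtain ⟨m0, hm0⟩ : ∃ m : M, a • b • m ≠ 0 := by
      by_contra! hcon
      apply h0
      have : a * b ∈ Module.annihilator R M :=
        Module.mem_annihilator.2 fun m => by rw [mul_smul, hcon]
      rw [hfaith] at this
      simpa using this
    have hb0 := h a (b • m0) (habM m0) hm0 ha
    apply hc
    intro m
    by_cases hm : a • b • m = 0
    · have := h a (b • (m + m0)) (habM _) (by rwa [smul_add, smul_add, hm, zero_add]) ha
      rw [smul_add] at this
      simpa using Submodule.sub_mem _ this hb0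
    · exact h a _ (habM m) hm ha
end

section
/- Let M be a finitely generated faithful multiplication R-module and N a proper submodule of M. Then N is a weakly J-submodule of M if and only if (N : M) is a weakly J-ideal of R. -/
theorem mem_colon_top_aux {R : Type*} [CommRing R] {M : Type*} [AddCommGroup M] [Module R M]
    (N : Submodule R M) (r : R) : r ∈ Submodule.colon N ⊤ ↔ ∀ m : M, r • m ∈ N := by
  rw [Submodule.mem_colon]
  exact ⟨fun h m => h m trivial, fun h m _ => h m⟩

theorem jacobsonColon_le_aux {R : Type*} [CommRing R] {M : Type*} [AddCommGroup M] [Module R M]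
    [Module.Finite R M] (hfaith : Module.annihilator R M = ⊥) (r : R)
    (hr : r ∈ jacobsonColon R M) : r ∈ (⊥ : Ideal R).jacobson := by
  have hr' := (mem_colon_top_aux _ _).1 hr
  obtain ⟨p, hp, hnd, hdeg, hz⟩ :=
    LinearMap.exists_monic_and_natDegree_eq_and_coeff_mem_pow_and_aeval_eq_zero R
      (algebraMap R (Module.End R M) r) (⊥ : Ideal R).jacobson (by
        rintro _ ⟨m, rfl⟩
        exact hr' m)
  rw [Polynomial.aeval_algebraMap_apply] at hz
  have h0 : p.eval r = 0 := by
    have : p.eval r ∈ Module.annihilator R M := by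
      rw [Module.mem_annihilator]
      intro m
      have := congrArg (fun f : Module.End R M => f m) hz
      simpa using this
    rwa [hfaith] at this
  have hrad : (⊥ : Ideal R).jacobson.IsRadical := Ideal.isRadical_jacobson _
  apply hrad
  refine ⟨p.natDegree, ?_⟩
  rw [Polynomial.eval_eq_sum_range, Finset.sum_range_succ, hp.coeff_natDegree, one_mul] at h0
  rw [eq_neg_of_add_eq_zero_right h0]
  refine neg_mem (sum_mem fun i hi => Ideal.mul_mem_right _ _ ?_)
  have hi' := Finset.mem_range.1 hi
  exact Ideal.pow_le_self (by omega) (hdeg i)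

theorem stmt7 {R : Type*} [CommRing R] {M : Type*} [AddCommGroup M] [Module R M]
    [Module.Finite R M] (hfaith : Module.annihilator R M = ⊥)
    (hmult : IsMultiplicationModule R M) (N : Submodule R M) (hN : N ≠ ⊤) :
    IsWeaklyJSubmodule N ↔ IsWeaklyJIdeal (Submodule.colon N ⊤) := by
  constructor
  · rintro ⟨-, h⟩
    refine ⟨fun ht => hN ?_, ?_⟩
    · rw [Ideal.eq_top_iff_one, mem_colon_top_aux] at ht
      rw [eq_top_iff]
      intro m _
      simpa using ht m
    · intro a b hab hne ha
      have ha' : a ∉ jacobsonColon R M := fun h' => ha (jacobsonColon_le_aux hfaith a h')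
      rw [mem_colon_top_aux] at hab ⊢
      have key : ∀ m : M, (a * b) • m ≠ 0 → b • m ∈ N := fun m hm =>
        h a (b • m) (by rw [smul_smul]; exact hab m) (by rwa [smul_smul]) ha'
      obtain ⟨m0, hm0⟩ : ∃ m0 : M, (a * b) • m0 ≠ 0 := by
        by_contra! hc
        have : a * b ∈ Module.annihilator R M := Module.mem_annihilator.2 hc
        rw [hfaith] at this
        exact hne this
      intro m
      by_cases hm : (a * b) • m = 0
      · have h1 := key (m + m0) (by rwa [smul_add, hm, zero_add])
        rw [smul_add] at h1
        exact (N.add_mem_iff_left (key m0 hm0)).1 h1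
      · exact key m hm
  · rintro ⟨-, h⟩
    refine ⟨hN, ?_⟩
    intro r m hrm hne hr
    have hrJ : r ∉ (⊥ : Ideal R).jacobson := fun h' => hr
      ((mem_colon_top_aux _ _).2 fun x => Submodule.smul_mem_smul h' trivial)
    obtain ⟨I, hI⟩ := hmult (Submodule.span R {m})
    have hmI : m ∈ I • (⊤ : Submodule R M) := hI ▸ Submodule.mem_span_singleton_self m
    have hmul : ∀ i ∈ I, r * i ∈ Submodule.colon N ⊤ := by
      intro i hi
      rw [mem_colon_top_aux]
      intro x
      have : i • x ∈ Submodule.span R {m} := hI ▸ Submodule.smul_mem_smul hi trivial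
      obtain ⟨c, hc⟩ := Submodule.mem_span_singleton.1 this
      rw [mul_smul, ← hc, smul_comm]
      exact N.smul_mem c hrm
    obtain ⟨i0, hi0, hri0⟩ : ∃ i ∈ I, r * i ≠ 0 := by
      by_contra! hc
      apply hne
      refine Submodule.smul_induction_on hmI ?_ ?_
      · intro i hi x _
        rw [smul_smul, hc i hi, zero_smul]
      · intro x y hx hy
        rw [smul_add, hx, hy, add_zero]
    have key : ∀ i ∈ I, r * i ≠ 0 → i ∈ Submodule.colon N ⊤ := fun i hi hne' =>
      h r i (hmul i hi) hne' hrJ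
    have hle : ∀ i ∈ I, i ∈ Submodule.colon N ⊤ := by
      intro i hi
      by_cases hz : r * i = 0
      · have h1 := key (i + i0) (I.add_mem hi hi0) (by rwa [mul_add, hz, zero_add])
        exact (Submodule.add_mem_iff_left _ (key i0 hi0 hri0)).1 h1
      · exact key i hi hz
    refine (Submodule.smul_le.2 ?_ : I • (⊤ : Submodule R M) ≤ N) hmI
    intro i hi x _
    exact (mem_colon_top_aux _ _).1 (hle i hi) x
end

section
/- Let N be a weakly J-submodule of a finitely generated faithful multiplication R-module M that is not a J-submodule. Then (N : M)·N = 0; in particular, N² = 0 (where N² = (N : M)²M). Additionally, if M is reduced, then N = 0. -/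
theorem stmt8 {R : Type*} [CommRing R] {M : Type*} [AddCommGroup M] [Module R M]
    [Module.Finite R M] (hfaith : Module.annihilator R M = ⊥)
    (hmult : IsMultiplicationModule R M) (N : Submodule R M)
    (hwk : IsWeaklyJSubmodule N) (hnotJ : ¬ IsJSubmodule N) :
    Submodule.colon N ⊤ • N = (⊥ : Submodule R M) ∧
    (Submodule.colon N ⊤) ^ 2 • (⊤ : Submodule R M) = (⊥ : Submodule R M) ∧
    ((∀ (a : R) (m : M), a ^ 2 • m = 0 → a • m = 0) → N = ⊥) := by
  have hcol : ∀ a : R, a ∈ Submodule.colon N ⊤ ↔ ∀ m : M, a • m ∈ N := by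
    intro a
    simp [Submodule.mem_colon]
  obtain ⟨hne, hw⟩ := hwk
  have hsub : ∀ a : R, a ∈ Submodule.colon N ⊤ → a ∈ jacobsonColon R M := by
    intro a ha
    rw [hcol] at ha
    by_contra hJ
    have h0 : ∃ x : M, a • x ≠ 0 := by
      by_contra! h
      apply hJ
      simp [jacobsonColon, Submodule.mem_colon, h]
    obtain ⟨x, hx⟩ := h0
    apply hne
    rw [eq_top_iff]
    intro y _
    by_cases hy : a • y = 0
    · have hxN := hw a x (ha x) hx hJ
      have hxy := hw a (x + y) (ha _) (by rwa [smul_add, hy, add_zero]) hJ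
      exact (N.add_mem_iff_right hxN).1 hxy
    · exact hw a y (ha y) hy hJ
  have h1 : ∃ (r : R) (m : M), r • m ∈ N ∧ r ∉ jacobsonColon R M ∧ m ∉ N := by
    by_contra! h
    exact hnotJ ⟨hne, h⟩
  obtain ⟨r, m, hrm, hr, hm⟩ := h1
  have hrm0 : r • m = 0 := by
    by_contra h
    exact hm (hw r m hrm h hr)
  have hrN : ∀ n ∈ N, r • n = 0 := by
    intro n hn
    by_contra h
    have := hw r (m + n) (by rw [smul_add, hrm0, zero_add]; exact N.smul_mem r hn)
      (by rwa [smul_add, hrm0, zero_add]) hr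
    exact hm ((N.add_mem_iff_left hn).1 this)
  have hra : ∀ a ∈ Submodule.colon N ⊤, r + a ∉ jacobsonColon R M := by
    intro a ha h
    exact hr (((jacobsonColon R M).add_mem_iff_left (hsub a ha)).1 h)
  have ham : ∀ a ∈ Submodule.colon N ⊤, a • m = 0 := by
    intro a ha
    by_contra h
    exact hm (hw (r + a) m (by rw [add_smul, hrm0, zero_add]; exact (hcol a).1 ha m)
      (by rwa [add_smul, hrm0, zero_add]) (hra a ha))
  have han : ∀ a ∈ Submodule.colon N ⊤, ∀ n ∈ N, a • n = 0 := by
    intro a ha n hn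
    by_contra h
    have e : (r + a) • (m + n) = a • n := by
      rw [smul_add, add_smul, add_smul, hrm0, hrN n hn, ham a ha]; simp
    have := hw (r + a) (m + n) (by rw [e]; exact N.smul_mem a hn) (by rwa [e]) (hra a ha)
    exact hm ((N.add_mem_iff_left hn).1 this)
  have hA : Submodule.colon N ⊤ • N = (⊥ : Submodule R M) := by
    rw [eq_bot_iff, Submodule.smul_le]
    intro a ha n hn
    simpa using han a ha n hn
  refine ⟨hA, ?_, ?_⟩
  · rw [eq_bot_iff, ← hA, pow_two, Submodule.mul_smul]
    refine Submodule.smul_mono le_rfl ?_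
    rw [Submodule.smul_le]
    intro a ha n _
    exact (hcol a).1 ha n
  · intro hred
    obtain ⟨I, hI⟩ := hmult N
    have hb : I • (⊤ : Submodule R M) ≤ ⊥ := by
      rw [Submodule.smul_le]
      intro a ha x _
      have haN : ∀ y : M, a • y ∈ N := by
        intro y
        rw [hI]
        exact Submodule.smul_mem_smul ha trivial
      have := han a ((hcol a).2 haN) _ (haN x)
      rw [Submodule.mem_bot]
      apply hred
      rw [pow_two, mul_smul, this]
    rw [eq_bot_iff]
    exact hI.le.trans hb
end

section
/- Let M be a finitely generated faithful multiplication R-module, S a subset of R with S ⊄ J(R), and N a weakly J-submodule of M with (0 :_M S) ⊆ N. Then (N :_M S) is a weakly J-submodule of M. -/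
/-- For a finitely generated faithful module, `(J(R)M : M) ≤ J(R)`. -/
theorem jacobsonColon_le_jacobson {R : Type*} [CommRing R] {M : Type*} [AddCommGroup M]
    [Module R M] [Module.Finite R M] (hfaith : Module.annihilator R M = ⊥) :
    jacobsonColon R M ≤ (⊥ : Ideal R).jacobson := by
  intro r hr
  have hr' : ∀ m : M, r • m ∈ (⊥ : Ideal R).jacobson • (⊤ : Submodule R M) := by
    intro m
    exact Submodule.mem_colon.1 hr m (by trivial)
  obtain ⟨p, hp, -, hpc, hp0⟩ :=
    LinearMap.exists_monic_and_natDegree_eq_and_coeff_mem_pow_and_aeval_eq_zero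
    R (algebraMap R (Module.End R M) r) (⊥ : Ideal R).jacobson (by
      rintro _ ⟨m, rfl⟩
      simpa using hr' m)
  rw [Polynomial.aeval_algebraMap_apply] at hp0
  have hev : p.eval r = 0 := by
    have : p.eval r ∈ Module.annihilator R M := by
      rw [Module.mem_annihilator]
      intro m
      simpa using LinearMap.congr_fun hp0 m
    rwa [hfaith, Ideal.mem_bot] at this
  rw [hp.as_sum] at hev
  simp only [Polynomial.eval_add, Polynomial.eval_pow, Polynomial.eval_X,
    Polynomial.eval_finsetSum, Polynomial.eval_mul, Polynomial.eval_C] at hev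
  have hpow : r ^ p.natDegree ∈ (⊥ : Ideal R).jacobson := by
    rw [eq_neg_of_add_eq_zero_left hev]
    refine neg_mem (sum_mem fun i hi => Ideal.mul_mem_right _ _ ?_)
    have hi' := Finset.mem_range.1 hi
    exact Ideal.pow_le_self (by omega) (hpc i)
  exact Ideal.isRadical_jacobson _ ⟨_, hpow⟩

theorem stmt10 {R : Type*} [CommRing R] {M : Type*} [AddCommGroup M] [Module R M]
    [Module.Finite R M] (hfaith : Module.annihilator R M = ⊥)
    (hmult : IsMultiplicationModule R M) (N : Submodule R M) (S : Set R)
    (hS : ¬ S ⊆ ((⊥ : Ideal R).jacobson : Set R))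
    (hN : IsWeaklyJSubmodule N) (h0 : setColon (⊥ : Submodule R M) S ≤ N) :
    IsWeaklyJSubmodule (setColon N S) := by 
  have hle : setColon N S ≤ N := by
    intro m hm
    simp only [setColon, Submodule.mem_iInf, Submodule.mem_comap, LinearMap.smul_apply,
      LinearMap.id_apply] at hm
    obtain ⟨s, hsS, hsJ⟩ := Set.not_subset.1 hS
    have key : ∀ r : R, r ∉ (⊥ : Ideal R).jacobson → r • m ∈ N → r • m ≠ 0 → m ∈ N :=
      fun r hr h1 h2 => hN.2 r m h1 h2 fun h => hr (jacobsonColon_le_jacobson hfaith h)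
    by_contra hmN
    have hs0 : s • m = 0 := by
      by_contra h
      exact hmN (key s hsJ (hm s hsS) h)
    apply hmN
    apply h0
    simp only [setColon, Submodule.mem_iInf, Submodule.mem_comap, LinearMap.smul_apply,
      LinearMap.id_apply, Submodule.mem_bot]
    intro t ht
    by_contra htm
    have htJ : t ∈ (⊥ : Ideal R).jacobson := by
      by_contra h
      exact hmN (key t h (hm t ht) htm)
    have hst : (s + t) • m = t • m := by rw [add_smul, hs0, zero_add]
    refine hmN (key (s + t) (fun h => hsJ ?_) (hst ▸ hm t ht) (hst ▸ htm))
    simpa using sub_mem h htJ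
  have hge : N ≤ setColon N S := by
    intro m hm
    simp only [setColon, Submodule.mem_iInf, Submodule.mem_comap, LinearMap.smul_apply,
      LinearMap.id_apply]
    exact fun s _ => N.smul_mem s hm
  rw [le_antisymm hle hge]
  exact hN
end

section
/- Let N be a proper submodule of a finitely generated faithful multiplication R-module M. Then N is a weakly J-submodule of M if and only if whenever K, L are submodules of M with KL ⊆ N and KL ≠ 0, then K ⊆ J(M) or L ⊆ N. -/
theorem aux_colon_smul {R : Type*} [CommRing R] {M : Type*} [AddCommGroup M] [Module R M]
    (hmult : IsMultiplicationModule R M) (K : Submodule R M) :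
    (Submodule.colon K ⊤ : Ideal R) • (⊤ : Submodule R M) = K := by
  apply le_antisymm
  · rw [Submodule.smul_le]
    intro r hr m _
    exact Submodule.mem_colon.1 hr m trivial
  · obtain ⟨I, hI⟩ := hmult K
    have h : I ≤ (Submodule.colon K ⊤ : Ideal R) := by
      intro r hr
      rw [Submodule.mem_colon]
      intro m _
      rw [hI]
      exact Submodule.smul_mem_smul hr trivial
    calc K = I • ⊤ := hI
      _ ≤ _ := Submodule.smul_mono_left h

theorem stmt12 {R : Type*} [CommRing R] {M : Type*} [AddCommGroup M] [Module R M]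
    [Module.Finite R M] (hfaith : Module.annihilator R M = ⊥)
    (hmult : IsMultiplicationModule R M) (N : Submodule R M) (hN : N ≠ ⊤) :
    IsWeaklyJSubmodule N ↔
      ∀ K L : Submodule R M,
        (Submodule.colon K ⊤ * Submodule.colon L ⊤) • (⊤ : Submodule R M) ≤ N →
        (Submodule.colon K ⊤ * Submodule.colon L ⊤) • (⊤ : Submodule R M) ≠ ⊥ →
        K ≤ (⊥ : Ideal R).jacobson • (⊤ : Submodule R M) ∨ L ≤ N := by
  constructor
  · rintro ⟨_, hw⟩ K L hle hne
    rw [Submodule.mul_smul, aux_colon_smul hmult L] at hle hne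
    by_contra hcon
    push Not at hcon
    obtain ⟨hK, hL⟩ := hcon
    obtain ⟨m', hm', hm'N⟩ := SetLike.not_le_iff_exists.1 hL
    have hA : ∃ a ∈ (Submodule.colon K ⊤ : Ideal R), a ∉ jacobsonColon R M := by
      by_contra hc
      push Not at hc
      apply hK
      rw [← aux_colon_smul hmult K, Submodule.smul_le]
      intro r hr m _
      exact Submodule.mem_colon.1 (hc r hr) m trivial
    have key : ∀ a ∈ (Submodule.colon K ⊤ : Ideal R), a ∉ jacobsonColon R M →
        ∀ m ∈ L, a • m = 0 := by
      intro a ha haJ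
      have h1 : ∀ m ∈ L, m ∉ N → a • m = 0 := by
        intro m hm hmN
        by_contra h0
        exact hmN (hw a m (hle (Submodule.smul_mem_smul ha hm)) h0 haJ)
      intro m hm
      by_cases hmN : m ∈ N
      · have h2 := h1 (m + m') (L.add_mem hm hm')
          (fun h => hm'N ((N.add_mem_iff_right hmN).1 h))
        rwa [smul_add, h1 m' hm' hm'N, add_zero] at h2
      · exact h1 m hm hmN
    obtain ⟨a, ha, haJ⟩ := hA
    apply hne
    rw [eq_bot_iff, Submodule.smul_le]
    intro b hb m hm
    rw [Submodule.mem_bot]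
    by_cases hbJ : b ∈ jacobsonColon R M
    · have h2 := key (a + b) (Ideal.add_mem _ ha hb)
        (fun h => haJ ((Submodule.add_mem_iff_left _ hbJ).1 h)) m hm
      rwa [add_smul, key a ha haJ m hm, zero_add] at h2
    · exact key b hb hbJ m hm
  · intro h
    refine ⟨hN, fun r m hrm h0 hr => ?_⟩
    have hprod : ((Submodule.colon (Ideal.span {r} • (⊤ : Submodule R M)) ⊤ : Ideal R) *
        Submodule.colon (Submodule.span R {m}) ⊤) • (⊤ : Submodule R M)
        = Submodule.span R {r • m} := by
      rw [mul_comm, Submodule.mul_smul, aux_colon_smul hmult, ← Submodule.mul_smul, mul_comm,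
        Submodule.mul_smul, aux_colon_smul hmult, Submodule.span_smul_span]
      simp
    rcases h (Ideal.span {r} • (⊤ : Submodule R M)) (Submodule.span R {m})
      (by rw [hprod, Submodule.span_singleton_le_iff_mem]; exact hrm)
      (by rw [hprod, Ne, Submodule.span_singleton_eq_bot]; exact h0) with h1 | h1
    · refine absurd (Submodule.mem_colon.2 fun x _ => h1 ?_) hr
      exact Submodule.smul_mem_smul (Ideal.mem_span_singleton_self r) trivial
    · exact h1 (Submodule.mem_span_singleton_self m)
end

section
/- If N is a weakly J-submodule of a finitely generated faithful multiplication R-module M, then N ⊆ J(M) = J(R)M. -/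
theorem stmt13 {R : Type*} [CommRing R] {M : Type*} [AddCommGroup M] [Module R M]
    [Module.Finite R M] (hfaith : Module.annihilator R M = ⊥)
    (hmult : IsMultiplicationModule R M) (N : Submodule R M) (hN : IsWeaklyJSubmodule N) :
    N ≤ (⊥ : Ideal R).jacobson • (⊤ : Submodule R M) := by
  obtain ⟨hne, h⟩ := hN
  obtain ⟨I, rfl⟩ := hmult N
  refine Submodule.smul_le.2 fun a ha m _ => ?_
  by_contra hm
  have hac : a ∉ jacobsonColon R M := fun hc =>
    hm (Submodule.mem_colon.1 hc m trivial)
  have ham : a • m ≠ 0 := fun h0 => hm (h0 ▸ Submodule.zero_mem _)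
  have key : ∀ x : M, a • x ≠ 0 → x ∈ I • (⊤ : Submodule R M) := fun x hx =>
    h a x (Submodule.smul_mem_smul ha trivial) hx hac
  apply hne
  refine eq_top_iff.2 fun n _ => ?_
  by_cases hn : a • n = 0
  · have h1 : m + n ∈ I • (⊤ : Submodule R M) := key _ (by rw [smul_add, hn, add_zero]; exact ham)
    exact (Submodule.add_mem_iff_right _ (key m ham)).1 h1
  · exact key n hn
end

section
/- Let φ : M₁ → M₂ be a surjective R-module homomorphism and N a weakly J-submodule of M₁ with ker(φ) ⊆ N. Then φ(N) is a weakly J-submodule of M₂. -/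
theorem stmt14 {R : Type*} [CommRing R] {M₁ M₂ : Type*} [AddCommGroup M₁] [Module R M₁]
    [AddCommGroup M₂] [Module R M₂] (φ : M₁ →ₗ[R] M₂) (hsurj : Function.Surjective φ)
    (N : Submodule R M₁) (hN : IsWeaklyJSubmodule N) (hker : LinearMap.ker φ ≤ N) :
    IsWeaklyJSubmodule (N.map φ) := by
  have hcomap : (N.map φ).comap φ = N := by
    rw [Submodule.comap_map_eq, sup_eq_left.mpr hker]
  refine ⟨?_, ?_⟩
  · intro h
    apply hN.1
    rw [← hcomap, h, Submodule.comap_top]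
  · intro r m hm hne hr
    obtain ⟨x, rfl⟩ := hsurj m
    refine Submodule.mem_map_of_mem (hN.2 r x ?_ ?_ ?_)
    · rw [← hcomap, Submodule.mem_comap, map_smul]
      exact hm
    · intro h
      apply hne
      rw [← map_smul, h, map_zero]
    · intro h
      apply hr
      unfold jacobsonColon at h ⊢
      rw [Submodule.mem_colon] at h ⊢
      intro y _
      obtain ⟨z, rfl⟩ := hsurj y
      have hz := Submodule.mem_map_of_mem (f := φ) (h z trivial)
      rw [Submodule.map_smul'', map_smul] at hz
      exact Submodule.smul_mono le_rfl le_top hz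
end

section
/- Every weakly J-submodule of a finitely generated faithful multiplication R-module M is small (superfluous) in M: if N is a weakly J-submodule and N + K = M for a submodule K, then K = M. -/
theorem stmt18 {R : Type*} [CommRing R] {M : Type*} [AddCommGroup M] [Module R M]
    [Module.Finite R M] (hfaith : Module.annihilator R M = ⊥)
    (hmult : IsMultiplicationModule R M) (N : Submodule R M) (hN : IsWeaklyJSubmodule N)
    (K : Submodule R M) (hK : N ⊔ K = ⊤) : K = ⊤ := by
  obtain ⟨hne, hw⟩ := hN
  obtain ⟨I, hI⟩ := hmult N
  obtain ⟨m0, hm0⟩ : ∃ m0, m0 ∉ N := by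
    by_contra! h
    exact hne (eq_top_iff.2 fun x _ => h x)
  have hle : N ≤ (⊥ : Ideal R).jacobson • (⊤ : Submodule R M) := by
    rw [hI, Submodule.smul_le]
    intro r hr m _
    have hrN : ∀ x : M, r • x ∈ N := fun x => by
      rw [hI]
      exact Submodule.smul_mem_smul hr trivial
    by_cases hc : r ∈ jacobsonColon R M
    · exact Submodule.mem_colon.1 hc m trivial
    · have hz : ∀ x : M, x ∉ N → r • x = 0 := fun x hx => by
        by_contra h0
        exact hx (hw r x (hrN x) h0 hc)
      have h0 : r • m = 0 := by
        by_cases hm : m ∈ N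
        · have h1 := hz (m0 + m) (fun h => hm0 ((N.add_mem_iff_left hm).1 h))
          rw [smul_add, hz m0 hm0, zero_add] at h1
          exact h1
        · exact hz m hm
      rw [h0]
      exact zero_mem _
  refine eq_top_iff.2 (Submodule.le_of_le_smul_of_le_jacobson_bot
    (I := (⊥ : Ideal R).jacobson) Module.Finite.fg_top le_rfl ?_)
  rw [← hK, sup_comm]
  refine sup_le_sup_left ?_ K
  rw [sup_comm, hK]
  exact hle
end

section
/- If N is a weakly primary submodule of an R-module M such that (N : M) ⊆ J(R), then N is a weakly J-submodule of M. -/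
theorem stmt19 {R : Type*} [CommRing R] {M : Type*} [AddCommGroup M] [Module R M]
    (N : Submodule R M) (hproper : N ≠ ⊤)
    (hwp : ∀ (r : R) (m : M), r • m ∈ N → r • m ≠ 0 →
      r ∈ (Submodule.colon N ⊤).radical ∨ m ∈ N)
    (hJ : Submodule.colon N ⊤ ≤ (⊥ : Ideal R).jacobson) :
    IsWeaklyJSubmodule N := by
  refine ⟨hproper, fun r m hm h0 hr => ?_⟩
  rcases hwp r m hm h0 with h | h
  · exfalso
    apply hr
    have hrJ : r ∈ (⊥ : Ideal R).jacobson := by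
      obtain ⟨n, hn⟩ := h
      exact (Ideal.isRadical_jacobson (⊥ : Ideal R)) ⟨n, hJ hn⟩
    exact Submodule.mem_colon.mpr fun x _ => Submodule.smul_mem_smul hrJ Submodule.mem_top
  · exact h
end
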